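/- arXiv:1512.08191 — 2 statements merged into one kernel-verified Lean document; each statement's English description precedes it below -/
import Mathlib

section
/- Let Y be a random vector in (ℝ₊)^d with independent entries, where Y_i follows a Gamma distribution with shape parameter L > 1 and mean μ_i > 0. Let μ̂ : ℝ^d → (ℝ₊)^d be continuously differentiable with bounded partial derivatives, and assume all the expectations below are finite. Define SUKLS_Gamma(Y) = ∑_{i=1}^d [ (L−1)·μ̂_i(Y)/Y_i − L·log μ̂_i(Y) − L ] + tr(∂μ̂/∂y)(Y). Then E[SUKLS_Gamma(Y)] equals, up to an additive constant independent of μ̂, the mean KL synthesis loss MKLS_Gamma = ∑_{i=1}^d E[ L·μ̂_i(Y)/μ_i − L·log(μ̂_i(Y)/μ_i) − L ]. -/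
open MeasureTheory ProbabilityTheory

/-- Integrability against a Gamma law, written as weighted integrability on `(0, ∞)`. -/
theorem integrable_gammaMeasure_iff {a r : ℝ} (ha : 0 < a) (hr : 0 < r) (f : ℝ → ℝ) :
    Integrable f (gammaMeasure a r) ↔
      IntegrableOn (fun x => r ^ a / Real.Gamma a * x ^ (a - 1) * Real.exp (-(r * x)) * f x)
        (Set.Ioi 0) := by
  rw [gammaMeasure, integrable_withDensity_iff_integrable_smul'
    (f := gammaPDF a r) (measurable_gammaPDFReal a r).ennreal_ofReal (ae_of_all _ fun _ => ENNReal.ofReal_lt_top),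
    ← integrableOn_Ici_iff_integrableOn_Ioi, ← integrable_indicator_iff measurableSet_Ici]
  refine integrable_congr (ae_of_all _ fun x => ?_)
  by_cases hx : 0 ≤ x
  · simp only [gammaPDF, ENNReal.toReal_ofReal (gammaPDFReal_nonneg ha hr x)]
    simp [gammaPDFReal, hx]
  · simp [gammaPDF, gammaPDFReal, hx]

/-- The integral against a Gamma law, written as a weighted integral on `(0, ∞)`. -/
theorem integral_gammaMeasure {a r : ℝ} (ha : 0 < a) (hr : 0 < r) (f : ℝ → ℝ) :
    ∫ x, f x ∂gammaMeasure a r =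
      ∫ x in Set.Ioi 0, r ^ a / Real.Gamma a * x ^ (a - 1) * Real.exp (-(r * x)) * f x := by
  rw [gammaMeasure, integral_withDensity_eq_integral_toReal_smul
    (f := gammaPDF a r) (measurable_gammaPDFReal a r).ennreal_ofReal (ae_of_all _ fun _ => ENNReal.ofReal_lt_top),
    ← integral_Ici_eq_integral_Ioi, ← integral_indicator measurableSet_Ici]
  refine integral_congr_ae (ae_of_all _ fun x => ?_)
  by_cases hx : 0 ≤ x
  · simp only [gammaPDF, ENNReal.toReal_ofReal (gammaPDFReal_nonneg ha hr x)]
    simp [gammaPDFReal, hx]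
  · simp [gammaPDF, gammaPDFReal, hx]

theorem integrable_rpow_gammaMeasure {a r s : ℝ} (ha : 0 < a) (hr : 0 < r) (hs : -a < s) :
    Integrable (fun x : ℝ => x ^ s) (gammaMeasure a r) := by
  rw [integrable_gammaMeasure_iff ha hr]
  have h := integrableOn_rpow_mul_exp_neg_mul_rpow (p := 1) (b := r) (s := a - 1 + s)
    (by linarith) one_pos hr
  refine IntegrableOn.congr_fun (h.const_mul (r ^ a / Real.Gamma a)) (fun x hx => ?_)
    measurableSet_Ioi
  simp only [Real.rpow_add hx, Real.rpow_one, neg_mul]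
  ring

/-- The integration-by-parts identity for the Gamma law with shape `a > 1` and rate `r`. -/
theorem integral_gammaMeasure_stein {a r A B : ℝ} (ha : 1 < a) (hr : 0 < r) {f f' : ℝ → ℝ}
    (hf : ∀ x, HasDerivAt f (f' x) x) (hbound : ∀ x, |f x| ≤ A + B * |x|)
    (hint : Integrable (fun x => (a - 1) * f x / x + f' x - r * f x) (gammaMeasure a r)) :
    ∫ x, ((a - 1) * f x / x + f' x - r * f x) ∂gammaMeasure a r = 0 := by
  have ha0 : 0 < a := by linarith
  rw [integrable_gammaMeasure_iff ha0 hr] at hint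
  rw [integral_gammaMeasure ha0 hr]
  set K := r ^ a / Real.Gamma a
  have hKpos : 0 < K := div_pos (Real.rpow_pos_of_pos hr _) (Real.Gamma_pos_of_pos ha0)
  have key := integral_Ioi_of_hasDerivAt_of_tendsto
    (f := fun x : ℝ => K * x ^ (a - 1) * Real.exp (-(r * x)) * f x) (a := 0) (m := 0)
    ?_ ?_ hint ?_
  · rw [key, Real.zero_rpow (by linarith)]
    simp
  · refine ContinuousAt.continuousWithinAt ?_
    have h1 : ContinuousAt (fun x : ℝ => x ^ (a - 1)) 0 :=
      Real.continuousAt_rpow_const _ _ (Or.inr (by linarith))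
    have h2 : ContinuousAt (fun x : ℝ => Real.exp (-(r * x))) 0 := by fun_prop
    exact ((continuousAt_const.mul h1).mul h2).mul (hf 0).continuousAt
  · intro x hx
    have hx0 : (0 : ℝ) < x := hx
    have h1 : HasDerivAt (fun x : ℝ => x ^ (a - 1)) ((a - 1) * x ^ (a - 1 - 1)) x :=
      Real.hasDerivAt_rpow_const (Or.inl hx0.ne')
    have h2 : HasDerivAt (fun x : ℝ => Real.exp (-(r * x))) (Real.exp (-(r * x)) * -(r * 1)) x :=
      (((hasDerivAt_id x).const_mul r).neg).exp
    convert! ((h1.const_mul K).mul h2).mul (hf x) using 1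
    simp only [Pi.mul_apply]
    rw [Real.rpow_sub_one hx0.ne' (a - 1)]
    generalize x ^ (a - 1) = w
    field_simp
    ring
  · have t1 := (tendsto_rpow_mul_exp_neg_mul_atTop_nhds_zero (a - 1) r hr).const_mul (K * A)
    have t2 := (tendsto_rpow_mul_exp_neg_mul_atTop_nhds_zero a r hr).const_mul (K * B)
    have t := t1.add t2
    simp only [mul_zero, add_zero] at t
    refine squeeze_zero_norm' ?_ t
    filter_upwards [Filter.eventually_gt_atTop 0] with x hx
    have hw : 0 < K * x ^ (a - 1) * Real.exp (-(r * x)) := by positivity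
    rw [norm_mul, Real.norm_of_nonneg hw.le, Real.norm_eq_abs]
    refine (mul_le_mul_of_nonneg_left (hbound x) hw.le).trans (le_of_eq ?_)
    have hxa : x ^ a = x ^ (a - 1) * x := by rw [Real.rpow_sub_one hx.ne']; field_simp
    rw [abs_of_pos hx, hxa, neg_mul]
    ring

/-- A differentiable function on `ℝ^d` with bounded partial derivatives grows at most linearly. -/
theorem abs_le_add_mul_norm_of_partial_bound {d : ℕ} {h : (Fin d → ℝ) → ℝ} {C : ℝ}
    (hh : Differentiable ℝ h) (hC : ∀ y j, |fderiv ℝ h y (Pi.single j 1)| ≤ C)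
    (y : Fin d → ℝ) : |h y| ≤ |h 0| + d * |C| * ‖y‖ := by
  have hb : ∀ x ∈ (Set.univ : Set (Fin d → ℝ)), ‖fderiv ℝ h x‖ ≤ d * |C| := by
    intro x _
    refine ContinuousLinearMap.opNorm_le_bound _ (by positivity) fun v => ?_
    have hv : fderiv ℝ h x v = ∑ j, v j * fderiv ℝ h x (Pi.single j 1) := by
      conv_lhs => rw [pi_eq_sum_univ' v]
      simp [map_sum, Pi.single]
    rw [hv]
    calc ‖∑ j, v j * fderiv ℝ h x (Pi.single j 1)‖
        ≤ ∑ j : Fin d, ‖v‖ * |C| := by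
          refine norm_sum_le_of_le _ fun j _ => ?_
          rw [norm_mul]
          exact mul_le_mul (norm_le_pi_norm v j) ((hC x j).trans (le_abs_self C))
            (norm_nonneg _) (norm_nonneg _)
      _ = d * |C| * ‖v‖ := by simp; ring
  have h1 := convex_univ.norm_image_sub_le_of_norm_fderiv_le (fun x _ => hh x) hb
    (Set.mem_univ 0) (Set.mem_univ y)
  rw [sub_zero, Real.norm_eq_abs] at h1
  have h2 := abs_add_le (h 0) (h y - h 0)
  rw [add_sub_cancel] at h2
  linarith

theorem norm_insertNth_le {n : ℕ} (i : Fin (n + 1)) (x : ℝ) (z : Fin n → ℝ) :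
    ‖(i.insertNth x z : Fin (n + 1) → ℝ)‖ ≤ |x| + ‖z‖ := by
  rw [pi_norm_le_iff_of_nonneg (by positivity)]
  intro j
  refine Fin.succAboveCases i ?_ (fun k => ?_) j
  · simp
  · simpa using (norm_le_pi_norm z k).trans (le_add_of_nonneg_left (abs_nonneg x))

theorem hasDerivAt_insertNth {n : ℕ} (i : Fin (n + 1)) (x : ℝ) (z : Fin n → ℝ) :
    HasDerivAt (fun x => (i.insertNth x z : Fin (n + 1) → ℝ)) (Pi.single i 1) x := by
  have h := hasDerivAt_update (i.insertNth 0 z : Fin (n + 1) → ℝ) i x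
  convert! h using 1
  ext x j
  simp

/-- The Gamma integration-by-parts identity in one coordinate of a product of Gamma laws. -/
theorem integral_pi_gammaMeasure_stein {d : ℕ} {a : ℝ} (ha : 1 < a) {r : Fin d → ℝ}
    (hr : ∀ i, 0 < r i) {h : (Fin d → ℝ) → ℝ} {C : ℝ} (hh : ContDiff ℝ 1 h)
    (hC : ∀ y j, |fderiv ℝ h y (Pi.single j 1)| ≤ C) (i : Fin d) :
    Integrable (fun y => (a - 1) * h y / y i + fderiv ℝ h y (Pi.single i 1) - r i * h y)
        (Measure.pi fun i => gammaMeasure a (r i)) ∧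
      ∫ y, ((a - 1) * h y / y i + fderiv ℝ h y (Pi.single i 1) - r i * h y)
        ∂(Measure.pi fun i => gammaMeasure a (r i)) = 0 := by
  have ha0 : 0 < a := by linarith
  have hprob : ∀ i, IsProbabilityMeasure (gammaMeasure a (r i)) := fun i =>
    isProbabilityMeasure_gammaMeasure ha0 (hr i)
  obtain ⟨n, rfl⟩ : ∃ n, d = n + 1 := ⟨d - 1, by have := i.isLt; omega⟩
  set A := |h 0|
  set B := ((n + 1 : ℕ) : ℝ) * |C|
  have hA : 0 ≤ A := abs_nonneg _
  have hB : 0 ≤ B := by positivity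
  have hdiff : Differentiable ℝ h := hh.differentiable one_ne_zero
  have hgrow : ∀ x z, |h (i.insertNth x z)| ≤ A + B * (|x| + ‖z‖) := fun x z =>
    (abs_le_add_mul_norm_of_partial_bound hdiff hC _).trans
      (add_le_add_right (mul_le_mul_of_nonneg_left (norm_insertNth_le i x z) hB) _)
  have hderiv : ∀ z x, HasDerivAt (fun x => h (i.insertNth x z))
      (fderiv ℝ h (i.insertNth x z) (Pi.single i 1)) x := fun z x =>
    (hdiff _).hasFDerivAt.comp_hasDerivAt x (hasDerivAt_insertNth i x z)
  set ν := Measure.pi fun j => gammaMeasure a (r (i.succAbove j))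
  set G : (Fin (n + 1) → ℝ) → ℝ := fun y =>
    (a - 1) * h y / y i + fderiv ℝ h y (Pi.single i 1) - r i * h y with hG
  have hmp := (measurePreserving_piFinSuccAbove (fun i => gammaMeasure a (r i)) i).symm
  have hGmeas : Measurable G := by
    have h1 : Measurable h := hh.continuous.measurable
    have h2 : Measurable fun y => fderiv ℝ h y (Pi.single i 1) :=
      ((hh.continuous_fderiv one_ne_zero).clm_apply continuous_const).measurable
    fun_prop
  have hinv : Integrable (fun x : ℝ => |x⁻¹|) (gammaMeasure a (r i)) := by
    simpa [Real.rpow_neg_one] using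
      (integrable_rpow_gammaMeasure (s := -1) ha0 (hr i) (by linarith)).abs
  have hid : ∀ i, Integrable (fun x : ℝ => |x|) (gammaMeasure a (r i)) := fun i => by
    simpa using (integrable_rpow_gammaMeasure (s := 1) ha0 (hr i) (by linarith)).abs
  have hnorm : Integrable (fun z : Fin n → ℝ => ‖z‖) ν := by
    have hsum : Integrable (fun z : Fin n → ℝ => ∑ j, |z j|) ν :=
      integrable_finsetSum _ fun j _ => integrable_comp_eval (hid (i.succAbove j))
    refine hsum.mono' (by fun_prop) (ae_of_all _ fun z => ?_)
    rw [norm_norm, pi_norm_le_iff_of_nonneg (by positivity)]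
    exact fun j => Finset.single_le_sum (f := fun j => |z j|) (fun _ _ => abs_nonneg _)
      (Finset.mem_univ j)
  have hprod : Integrable (fun p : ℝ × (Fin n → ℝ) => G (i.insertNth p.1 p.2))
      ((gammaMeasure a (r i)).prod ν) := by
    have e1 := hinv.comp_fst ν
    have e2 := hinv.mul_prod hnorm
    have e3 := (hid i).comp_fst ν
    have e4 := hnorm.comp_snd (gammaMeasure a (r i))
    have hD : Integrable (fun p : ℝ × (Fin n → ℝ) =>
        (a - 1) * (A * |p.1⁻¹| + B + B * (|p.1⁻¹| * ‖p.2‖)) + C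
          + r i * (A + B * |p.1| + B * ‖p.2‖)) ((gammaMeasure a (r i)).prod ν) :=
      (((((e1.const_mul A).add (integrable_const B)).add (e2.const_mul B)).const_mul _).add
        (integrable_const C)).add
        ((((integrable_const A).add (e3.const_mul B)).add (e4.const_mul B)).const_mul _)
    refine hD.mono' ?_ (ae_of_all _ fun p => ?_)
    · exact (hGmeas.comp
        (MeasurableEquiv.piFinSuccAbove (fun _ => ℝ) i).symm.measurable).aestronglyMeasurable
    · have b1 := hgrow p.1 p.2
      have b2 := hC (i.insertNth p.1 p.2) i
      have b3 : |p.1⁻¹| * |p.1| ≤ 1 := by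
        rw [← abs_mul]
        by_cases h0 : p.1 = 0 <;> simp [h0]
      have b4 : |(a - 1) * h (i.insertNth p.1 p.2) / p.1|
          ≤ (a - 1) * (A * |p.1⁻¹| + B + B * (|p.1⁻¹| * ‖p.2‖)) := by
        rw [mul_div_assoc, abs_mul, abs_of_pos (sub_pos.2 ha), div_eq_mul_inv, abs_mul]
        refine mul_le_mul_of_nonneg_left ?_ (sub_pos.2 ha).le
        have := mul_le_mul_of_nonneg_right b1 (abs_nonneg p.1⁻¹)
        have := mul_le_mul_of_nonneg_left b3 hB
        linarith
      have b5 : |r i * h (i.insertNth p.1 p.2)| ≤ r i * (A + B * |p.1| + B * ‖p.2‖) := by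
        rw [abs_mul, abs_of_pos (hr i)]
        exact mul_le_mul_of_nonneg_left (by linarith) (hr i).le
      simp only [hG, Real.norm_eq_abs, Fin.insertNth_apply_same]
      refine (abs_sub _ _).trans (add_le_add ((abs_add_le _ _).trans (add_le_add b4 b2)) b5)
  constructor
  · rw [← hmp.integrable_comp_emb (MeasurableEquiv.measurableEmbedding _)]
    exact hprod
  · rw [← hmp.integral_comp']
    change ∫ p : ℝ × (Fin n → ℝ), G (i.insertNth p.1 p.2) ∂((gammaMeasure a (r i)).prod ν) = 0
    rw [integral_prod_symm _ hprod]
    refine integral_eq_zero_of_ae ?_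
    filter_upwards [hprod.prod_left_ae] with z hz
    simp only [hG, Fin.insertNth_apply_same] at hz ⊢
    exact integral_gammaMeasure_stein (A := A + B * ‖z‖) (B := B) ha (hr i) (hderiv z)
      (fun x => (hgrow x z).trans (by linarith)) hz

/-- under i.i.d.-entry Gamma noise with shape `L > 1` and means `μ_i > 0`,
`E[SUKLS_Gamma(Y)]` equals the mean KL synthesis loss
`MKLS_Gamma = ∑ i E[L μ̂_i(Y)/μ_i − L log(μ̂_i(Y)/μ_i) − L]` up to an additive constant `c`
independent of the predictor `μ̂`. -/
theorem sukls_gamma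
    {Ω : Type*} [MeasurableSpace Ω] (P : Measure Ω) [IsProbabilityMeasure P]
    (d : ℕ) (L : ℝ) (hL : 1 < L) (μ : Fin d → ℝ) (hμ : ∀ i, 0 < μ i)
    (Y : Ω → Fin d → ℝ) (hmeas : Measurable Y)
    (hlaw : P.map Y = Measure.pi (fun i => gammaMeasure L (L / μ i))) :
    ∃ c : ℝ, ∀ hatμ : (Fin d → ℝ) → (Fin d → ℝ),
      ContDiff ℝ 1 hatμ →
      (∃ C : ℝ, ∀ y i j, |fderiv ℝ hatμ y (Pi.single j 1) i| ≤ C) →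
      (∀ y i, 0 < hatμ y i) →
      Integrable (fun ω =>
        (∑ i, ((L - 1) * hatμ (Y ω) i / Y ω i - L * Real.log (hatμ (Y ω) i) - L))
          + ∑ i, fderiv ℝ hatμ (Y ω) (Pi.single i 1) i) P →
      Integrable (fun ω =>
        ∑ i, (L * hatμ (Y ω) i / μ i - L * Real.log (hatμ (Y ω) i / μ i) - L)) P →
      ∫ ω, ((∑ i, ((L - 1) * hatμ (Y ω) i / Y ω i - L * Real.log (hatμ (Y ω) i) - L))
          + ∑ i, fderiv ℝ hatμ (Y ω) (Pi.single i 1) i) ∂P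
        = (∫ ω, ∑ i, (L * hatμ (Y ω) i / μ i - L * Real.log (hatμ (Y ω) i / μ i) - L) ∂P)
          + c := by
  have hL0 : 0 < L := by linarith
  have hr : ∀ i, 0 < L / μ i := fun i => div_pos hL0 (hμ i)
  refine ⟨-∑ i, L * Real.log (μ i), ?_⟩
  rintro hatμ hsmooth ⟨C, hC⟩ hpos hint₁ hint₂
  have hcomp : ∀ i, ContDiff ℝ 1 fun y => hatμ y i := contDiff_pi.1 hsmooth
  have hfd : ∀ i y v, fderiv ℝ (fun y => hatμ y i) y v = fderiv ℝ hatμ y v i := fun i y v => by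
    rw [fderiv_apply (hsmooth.differentiable one_ne_zero y)]
    rfl
  have hstein := fun i => integral_pi_gammaMeasure_stein hL hr (hcomp i)
    (fun y j => by rw [hfd]; exact hC y i j) i
  simp only [hfd, ← hlaw] at hstein
  have hY : ∀ i, Integrable (fun ω => (L - 1) * hatμ (Y ω) i / Y ω i
      + fderiv ℝ hatμ (Y ω) (Pi.single i 1) i - L / μ i * hatμ (Y ω) i) P := fun i =>
    (hstein i).1.comp_measurable hmeas
  have hY0 : ∀ i, ∫ ω, ((L - 1) * hatμ (Y ω) i / Y ω i
      + fderiv ℝ hatμ (Y ω) (Pi.single i 1) i - L / μ i * hatμ (Y ω) i) ∂P = 0 := fun i => by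
    rw [← (hstein i).2, integral_map hmeas.aemeasurable (hstein i).1.aestronglyMeasurable]
  rw [← sub_eq_iff_eq_add', ← integral_sub hint₁ hint₂]
  calc _ = ∫ ω, ((∑ i, ((L - 1) * hatμ (Y ω) i / Y ω i
      + fderiv ℝ hatμ (Y ω) (Pi.single i 1) i - L / μ i * hatμ (Y ω) i))
        + -∑ i, L * Real.log (μ i)) ∂P := by
        refine integral_congr_ae (ae_of_all _ fun ω => ?_)
        simp only [← Finset.sum_add_distrib, ← Finset.sum_sub_distrib, ← Finset.sum_neg_distrib]
        refine Finset.sum_congr rfl fun i _ => ?_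
        rw [Real.log_div (hpos _ i).ne' (hμ i).ne']
        ring
    _ = -∑ i, L * Real.log (μ i) := by
        rw [integral_add (integrable_finsetSum _ fun i _ => hY i) (integrable_const _),
          integral_finsetSum _ fun i _ => hY i]
        simp [hY0]
end

section
/- (Poisson Unbiased KLA estimator) Let Y be a random vector in ℕ^d with independent entries, where Y_i follows a Poisson distribution with mean μ_i > 0. Let μ̂ : ℕ^d → (ℝ₊)^d be any map such that the expectations below are finite. Define PUKLA(Y) = ∑_{i=1}^d μ̂_i(Y) − ∑_{i=1}^d Y_i·log μ̂_i(Y − e_i), where e_i is the i-th standard basis vector. Then E[PUKLA(Y)] = MKLA_Poisson + ∑_{i=1}^d μ_i − ∑_{i=1}^d μ_i·log μ_i, where MKLA_Poisson = E[∑_{i=1}^d μ̂_i(Y) − ∑_{i=1}^d μ_i·(log μ̂_i(Y) − log μ_i)] − ∑_{i=1}^d μ_i. -/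
open MeasureTheory ProbabilityTheory

open scoped NNReal ENNReal

lemma succ_mul_poissonMeasure_singleton_succ (r : ℝ≥0) (n : ℕ) :
    ((n + 1 : ℕ) : ℝ≥0∞) * poissonMeasure r {n + 1} = r * poissonMeasure r {n} := by
  rw [poissonMeasure_singleton, poissonMeasure_singleton, ← ENNReal.ofReal_natCast,
    ← ENNReal.ofReal_coe_nnreal, ← ENNReal.ofReal_mul (by positivity),
    ← ENNReal.ofReal_mul (by positivity)]
  congr 1
  rw [Nat.factorial_succ, pow_succ]
  push_cast
  field_simp

section Shift

variable {ι : Type*} [Fintype ι] [DecidableEq ι] (μ : ι → ℝ≥0) (i : ι)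

/-- Size-biasing a product of Poisson laws in one coordinate amounts to shifting that coordinate
by one. -/
lemma pi_poissonMeasure_withDensity_apply :
    (Measure.pi fun j ↦ poissonMeasure (μ j)).withDensity (fun y ↦ (y i : ℝ≥0∞)) =
      (μ i : ℝ≥0∞) • (Measure.pi fun j ↦ poissonMeasure (μ j)).map (· + Pi.single i 1) := by
  refine Measure.ext_of_singleton fun y ↦ ?_
  rw [withDensity_apply _ (measurableSet_singleton y), lintegral_singleton, Measure.smul_apply,
    Measure.map_apply .of_discrete (measurableSet_singleton y), smul_eq_mul]
  rcases Nat.eq_zero_or_pos (y i) with hy | hy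
  · have : (· + Pi.single i 1) ⁻¹' {y} = (∅ : Set (ι → ℕ)) := by
      ext z
      simp only [Set.mem_preimage, Set.mem_singleton_iff, Set.mem_empty_iff_false, iff_false]
      rintro rfl
      simp at hy
    simp [this, hy]
  · obtain ⟨z, rfl⟩ : ∃ z : ι → ℕ, y = z + Pi.single i 1 := by
      refine ⟨y - Pi.single i 1, (tsub_add_cancel_of_le fun j ↦ ?_).symm⟩
      rcases eq_or_ne j i with rfl | hj
      · simpa [Nat.one_le_iff_ne_zero] using hy.ne'
      · simp [hj]
    have : (· + Pi.single i 1) ⁻¹' {z + Pi.single i 1} = ({z} : Set (ι → ℕ)) := by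
      ext w
      simp
    rw [this, Measure.pi_singleton, Measure.pi_singleton,
      ← Finset.mul_prod_erase _ _ (Finset.mem_univ i),
      ← Finset.mul_prod_erase Finset.univ (fun j ↦ poissonMeasure (μ j) {z j}) (Finset.mem_univ i),
      ← mul_assoc, ← mul_assoc]
    congr 1
    · simpa using succ_mul_poissonMeasure_singleton_succ (μ i) (z i)
    · refine Finset.prod_congr rfl fun j hj ↦ ?_
      simp [Finset.ne_of_mem_erase hj]

variable {μ i}

lemma integrable_pi_poissonMeasure_mul_sub_single {f : (ι → ℕ) → ℝ}
    (hf : Integrable f (Measure.pi fun j ↦ poissonMeasure (μ j))) :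
    Integrable (fun y ↦ (y i : ℝ) * f (y - Pi.single i 1))
      (Measure.pi fun j ↦ poissonMeasure (μ j)) := by
  have h : Integrable (fun y ↦ f (y - Pi.single i 1))
      ((Measure.pi fun j ↦ poissonMeasure (μ j)).withDensity (fun y ↦ (y i : ℝ≥0∞))) := by
    rw [pi_poissonMeasure_withDensity_apply]
    refine Integrable.smul_measure ?_ ENNReal.coe_ne_top
    rw [integrable_map_measure .of_discrete .of_discrete]
    simpa [Function.comp_def] using hf
  rw [integrable_withDensity_iff .of_discrete (by simp)] at h
  simpa [mul_comm] using h

variable (μ i)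

/-- The Chen–Stein identity for one coordinate of a product of Poisson laws. -/
lemma integral_pi_poissonMeasure_mul_sub_single (f : (ι → ℕ) → ℝ) :
    ∫ y, (y i : ℝ) * f (y - Pi.single i 1) ∂(Measure.pi fun j ↦ poissonMeasure (μ j)) =
      μ i * ∫ y, f y ∂(Measure.pi fun j ↦ poissonMeasure (μ j)) := by
  have h := integral_withDensity_eq_integral_toReal_smul
    (μ := Measure.pi fun j ↦ poissonMeasure (μ j)) (f := fun y ↦ (y i : ℝ≥0∞)) .of_discrete
    (by simp) (fun y ↦ f (y - Pi.single i 1))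
  rw [pi_poissonMeasure_withDensity_apply, integral_smul_measure,
    integral_map .of_discrete .of_discrete] at h
  simpa using h.symm

end Shift

lemma mul_log_le_half_add {m x : ℝ} (hm : 0 < m) (hx : 0 < x) :
    m * Real.log x ≤ x / 2 + m * Real.log (2 * m) := by
  have h := Real.log_le_sub_one_of_pos (x := x / (2 * m)) (by positivity)
  rw [Real.log_div hx.ne' (by positivity)] at h
  have h' := mul_le_mul_of_nonneg_left h hm.le
  have : m * (x / (2 * m) - 1) = x / 2 - m := by field_simp
  linarith

/-- Integrability of the Poisson loss, summed over coordinates, forces integrability of the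
estimate and of its logarithm in each coordinate. -/
lemma integrable_and_integrable_log_of_sum_sub_mul_log {α ι : Type*} [Fintype ι]
    [MeasurableSpace α] {ν : Measure α} [IsFiniteMeasure ν] {m : ι → ℝ} (hm : ∀ i, 0 < m i)
    {g : α → ι → ℝ} (hg : Measurable g) (hpos : ∀ y i, 0 < g y i)
    (hint : Integrable (fun y ↦ ∑ i, (g y i - m i * Real.log (g y i))) ν) (i : ι) :
    Integrable (fun y ↦ g y i) ν ∧ Integrable (fun y ↦ Real.log (g y i)) ν := by
  have hgi (i : ι) : Measurable fun y ↦ g y i := (measurable_pi_apply i).comp hg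
  set k : α → ι → ℝ := fun y i ↦ g y i - m i * Real.log (g y i) + m i * Real.log (2 * m i)
    with hk
  have hkg (y : α) (i : ι) : g y i / 2 ≤ k y i := by
    have := mul_log_le_half_add (hm i) (hpos y i)
    simp only [hk]
    linarith
  have hk0 (y : α) (i : ι) : 0 ≤ k y i := by linarith [hkg y i, hpos y i]
  have hsum : Integrable (fun y ↦ ∑ i, k y i) ν := by
    simp only [hk, Finset.sum_add_distrib (g := fun i ↦ m i * Real.log (2 * m i))]
    exact hint.add (integrable_const _)
  have hki : Integrable (fun y ↦ k y i) ν := by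
    refine hsum.mono' (by fun_prop) (.of_forall fun y ↦ ?_)
    rw [Real.norm_of_nonneg (hk0 y i)]
    exact Finset.single_le_sum (fun j _ ↦ hk0 y j) (Finset.mem_univ i)
  have hgint : Integrable (fun y ↦ g y i) ν := by
    refine (hki.const_mul 2).mono' (by fun_prop) (.of_forall fun y ↦ ?_)
    rw [Real.norm_of_nonneg (hpos y i).le]
    linarith [hkg y i]
  refine ⟨hgint, ?_⟩
  refine (((hgint.sub hki).add (integrable_const (m i * Real.log (2 * m i)))).const_mul
    (m i)⁻¹).congr (.of_forall fun y ↦ ?_)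
  have := (hm i).ne'
  simp only [hk, Pi.add_apply, Pi.sub_apply]
  field_simp
  ring

/-- Poisson Unbiased KLA estimator: for `Y` with independent Poisson entries
of means `μ_i > 0` and any `μ̂ : ℕ^d → (ℝ₊)^d` with finite expectations,
`E[PUKLA(Y)] = MKLA_Poisson + ∑ i μ_i − ∑ i μ_i log μ_i`, where
`PUKLA(Y) = ∑ i μ̂_i(Y) − ∑ i Y_i log μ̂_i(Y − e_i)` and
`MKLA_Poisson = E[∑ i μ̂_i(Y) − ∑ i μ_i (log μ̂_i(Y) − log μ_i)] − ∑ i μ_i`. -/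
theorem pukla_unbiased
    {Ω : Type*} [MeasurableSpace Ω] (P : Measure Ω) [IsProbabilityMeasure P]
    (d : ℕ) (μ : Fin d → NNReal) (hμ : ∀ i, 0 < μ i)
    (Y : Ω → Fin d → ℕ) (hmeas : Measurable Y)
    (hlaw : P.map Y = Measure.pi (fun i => poissonMeasure (μ i)))
    (hatμ : (Fin d → ℕ) → (Fin d → ℝ)) (hatpos : ∀ y i, 0 < hatμ y i)
    (hint1 : Integrable (fun ω =>
      (∑ i, hatμ (Y ω) i)
        - ∑ i, (Y ω i : ℝ) * Real.log (hatμ (Y ω - Pi.single i 1) i)) P)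
    (hint2 : Integrable (fun ω =>
      (∑ i, hatμ (Y ω) i)
        - ∑ i, (μ i : ℝ) * (Real.log (hatμ (Y ω) i) - Real.log (μ i))) P) :
    ∫ ω, ((∑ i, hatμ (Y ω) i)
        - ∑ i, (Y ω i : ℝ) * Real.log (hatμ (Y ω - Pi.single i 1) i)) ∂P
      = ((∫ ω, ((∑ i, hatμ (Y ω) i)
            - ∑ i, (μ i : ℝ) * (Real.log (hatμ (Y ω) i) - Real.log (μ i))) ∂P)
          - ∑ i, (μ i : ℝ))
        + (∑ i, (μ i : ℝ)) - ∑ i, (μ i : ℝ) * Real.log (μ i) := by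
  set ν : Measure (Fin d → ℕ) := Measure.pi fun i ↦ poissonMeasure (μ i) with hν
  have htransfer (F : (Fin d → ℕ) → ℝ) : ∫ ω, F (Y ω) ∂P = ∫ y, F y ∂ν := by
    rw [← hlaw, integral_map hmeas.aemeasurable .of_discrete]
  have hloss : Integrable (fun y ↦ (∑ i, hatμ y i)
      - ∑ i, (μ i : ℝ) * (Real.log (hatμ y i) - Real.log (μ i))) ν := by
    rw [← hlaw, integrable_map_measure .of_discrete hmeas.aemeasurable]
    exact hint2
  have hloss' : Integrable (fun y ↦ ∑ i, (hatμ y i - (μ i : ℝ) * Real.log (hatμ y i))) ν := by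
    refine (hloss.sub (integrable_const (∑ i, (μ i : ℝ) * Real.log (μ i)))).congr
      (.of_forall fun y ↦ ?_)
    simp only [Pi.sub_apply, mul_sub, Finset.sum_sub_distrib]
    ring
  have hcoord := integrable_and_integrable_log_of_sum_sub_mul_log (ν := ν)
    (m := fun i ↦ (μ i : ℝ)) (fun i ↦ by exact_mod_cast hμ i) .of_discrete hatpos hloss'
  have hsum : Integrable (fun y ↦ ∑ i, hatμ y i) ν :=
    integrable_finsetSum _ fun i _ ↦ (hcoord i).1
  have hshift (i : Fin d) :
      Integrable (fun y ↦ (y i : ℝ) * Real.log (hatμ (y - Pi.single i 1) i)) ν :=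
    integrable_pi_poissonMeasure_mul_sub_single (f := fun y ↦ Real.log (hatμ y i)) (hcoord i).2
  have hlog (i : Fin d) :
      Integrable (fun y ↦ (μ i : ℝ) * (Real.log (hatμ y i) - Real.log (μ i))) ν :=
    ((hcoord i).2.sub (integrable_const _)).const_mul _
  refine (htransfer fun y ↦ (∑ i, hatμ y i)
      - ∑ i, (y i : ℝ) * Real.log (hatμ (y - Pi.single i 1) i)).trans ?_
  rw [htransfer fun y ↦ (∑ i, hatμ y i)
      - ∑ i, (μ i : ℝ) * (Real.log (hatμ y i) - Real.log (μ i)),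
    integral_sub hsum (integrable_finsetSum _ fun i _ ↦ hshift i),
    integral_sub hsum (integrable_finsetSum _ fun i _ ↦ hlog i),
    integral_finsetSum _ fun i _ ↦ hshift i, integral_finsetSum _ fun i _ ↦ hlog i]
  have hstein (i : Fin d) :
      ∫ y, (y i : ℝ) * Real.log (hatμ (y - Pi.single i 1) i) ∂ν =
        μ i * ∫ y, Real.log (hatμ y i) ∂ν :=
    integral_pi_poissonMeasure_mul_sub_single μ i fun y ↦ Real.log (hatμ y i)
  have hmean (i : Fin d) :
      ∫ y, (μ i : ℝ) * (Real.log (hatμ y i) - Real.log (μ i)) ∂ν =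
        μ i * ∫ y, Real.log (hatμ y i) ∂ν - μ i * Real.log (μ i) := by
    rw [integral_const_mul, integral_sub (hcoord i).2 (integrable_const _), integral_const,
      probReal_univ, one_smul, mul_sub]
  simp only [hstein, hmean, Finset.sum_sub_distrib]
  ring
end
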